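/- arXiv:1003.0219 — 2 statements merged into one kernel-verified Lean document; each statement's English description precedes it below -/
import Mathlib

section
/- Let h be a standard Gaussian vector in ℝ^L, 2 < T ≤ L, and define C = sqrt(∑_{i=1}^L h_i²) / sqrt(∑_{i=1}^T h_i²). Then E[C] ≤ sqrt((L-2)/(T-2)). -/
open MeasureTheory ProbabilityTheory

theorem integrable_sq_gaussianReal (μ : ℝ) (v : NNReal) :
    Integrable (fun x : ℝ => x ^ 2) (gaussianReal μ v) :=
  (memLp_id_gaussianReal' 2 (by simp)).integrable_sq

theorem integral_sq_gaussianReal_zero (v : NNReal) :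
    ∫ x, x ^ 2 ∂(gaussianReal 0 v) = v := by
  have h := variance_of_integral_eq_zero (μ := gaussianReal 0 v) (X := id)
    measurable_id.aemeasurable (by simp)
  rw [variance_id_gaussianReal] at h
  exact h.symm

theorem integrable_exp_neg_mul_sq_gaussianReal {t : ℝ} (ht : 0 ≤ t) (μ : ℝ) (v : NNReal) :
    Integrable (fun x : ℝ => Real.exp (-(t * x ^ 2))) (gaussianReal μ v) := by
  refine Integrable.of_bound (by fun_prop) 1 (Filter.Eventually.of_forall fun x => ?_)
  rw [Real.norm_eq_abs, Real.abs_exp, Real.exp_le_one_iff]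
  have := mul_nonneg ht (sq_nonneg x)
  linarith

theorem integral_exp_neg_mul_sq_gaussianReal {t : ℝ} (ht : 0 ≤ t) :
    ∫ x, Real.exp (-(t * x ^ 2)) ∂(gaussianReal 0 1) = (1 + 2 * t) ^ (-(1 / 2) : ℝ) := by
  rw [integral_gaussianReal_eq_integral_smul one_ne_zero]
  have h : ∀ x : ℝ, gaussianPDFReal 0 1 x • Real.exp (-(t * x ^ 2)) =
      (√(2 * Real.pi))⁻¹ * Real.exp (-(t + 1 / 2) * x ^ 2) := fun x => by
    simp only [gaussianPDFReal, NNReal.coe_one, mul_one, sub_zero, smul_eq_mul]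
    rw [mul_assoc, ← Real.exp_add]
    ring_nf
  simp_rw [h]
  rw [integral_const_mul, integral_gaussian, Real.rpow_neg (by positivity), ← Real.sqrt_eq_rpow,
    ← Real.sqrt_inv, ← Real.sqrt_inv, ← Real.sqrt_mul (by positivity)]
  congr 1
  have := Real.pi_ne_zero
  field_simp
  ring

theorem lintegral_one_add_two_mul_rpow {p : ℝ} (hp : 2 < p) :
    ∫⁻ t in Set.Ioi (0 : ℝ), ENNReal.ofReal ((1 + 2 * t) ^ (-(p / 2))) =
      ENNReal.ofReal (1 / (p - 2)) := by
  have hp' : p - 2 ≠ 0 := by linarith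
  have hd : ∀ t ∈ Set.Ici (0 : ℝ), HasDerivAt
      (fun t : ℝ => -(1 / (p - 2)) * (1 + 2 * t) ^ (-((p - 2) / 2)))
      ((1 + 2 * t) ^ (-(p / 2))) t := fun t ht => by
    have ht : (0 : ℝ) ≤ t := ht
    have h1 : HasDerivAt (fun t : ℝ => 1 + 2 * t) 2 t := by
      simpa using ((hasDerivAt_id t).const_mul 2).const_add 1
    have h2 := (h1.rpow_const (p := -((p - 2) / 2)) (Or.inl (by positivity))).const_mul
      (-(1 / (p - 2)))
    convert! h2 using 1
    rw [show -((p - 2) / 2) - 1 = -(p / 2) by ring]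
    field_simp
  have hnn : ∀ t ∈ Set.Ioi (0 : ℝ), 0 ≤ (1 + 2 * t) ^ (-(p / 2)) := fun t ht => by
    have ht : (0 : ℝ) < t := ht
    positivity
  have hlim : Filter.Tendsto (fun t : ℝ => -(1 / (p - 2)) * (1 + 2 * t) ^ (-((p - 2) / 2)))
      Filter.atTop (nhds 0) := by
    have h1 : Filter.Tendsto (fun t : ℝ => 1 + 2 * t) Filter.atTop Filter.atTop :=
      Filter.tendsto_atTop_add_const_left _ _
        (Filter.tendsto_id.const_mul_atTop (by norm_num : (0 : ℝ) < 2))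
    simpa using ((tendsto_rpow_neg_atTop (y := (p - 2) / 2) (by linarith)).comp h1).const_mul
      (-(1 / (p - 2)))
  rw [← ofReal_integral_eq_lintegral_ofReal (integrableOn_Ioi_deriv_of_nonneg' hd hnn hlim)
    (ae_restrict_of_forall_mem measurableSet_Ioi hnn),
    integral_Ioi_of_hasDerivAt_of_nonneg' hd hnn hlim]
  simp

theorem lintegral_sq_mul_exp_neg_mul_sum_sq_pi_gaussianReal {ι : Type*} [Fintype ι]
    {s : Finset ι} {j : ι} (hj : j ∉ s) {t : ℝ} (ht : 0 ≤ t) :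
    ∫⁻ h : ι → ℝ, ENNReal.ofReal (h j ^ 2 * Real.exp (-(t * ∑ i ∈ s, h i ^ 2)))
        ∂(Measure.pi fun _ => gaussianReal 0 1) =
      ENNReal.ofReal ((1 + 2 * t) ^ (-((s.card : ℝ) / 2))) := by
  classical
  let f : ι → ℝ → ℝ := fun i x =>
    (if i = j then x ^ 2 else 1) * if i ∈ s then Real.exp (-(t * x ^ 2)) else 1
  have hf : ∀ h : ι → ℝ, ∏ i, f i (h i) = h j ^ 2 * Real.exp (-(t * ∑ i ∈ s, h i ^ 2)) :=
    fun h => by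
      simp only [f, Finset.prod_mul_distrib, Finset.prod_ite_eq', Finset.mem_univ, if_true,
        Finset.prod_ite_mem, Finset.univ_inter]
      rw [← Real.exp_sum, Finset.sum_neg_distrib, Finset.mul_sum]
  have hint : ∀ i, Integrable (f i) (gaussianReal 0 1) := fun i => by
    by_cases hi : i = j
    · subst hi
      simpa [f, hj] using integrable_sq_gaussianReal 0 1
    · by_cases his : i ∈ s
      · simpa [f, hi, his] using integrable_exp_neg_mul_sq_gaussianReal ht 0 1
      · simp [f, hi, his]
  have hval : ∀ i, ∫ x, f i x ∂(gaussianReal 0 1) =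
      if i ∈ s then (1 + 2 * t) ^ (-(1 / 2) : ℝ) else 1 := fun i => by
    by_cases hi : i = j
    · subst hi
      simpa [f, hj] using integral_sq_gaussianReal_zero 1
    · by_cases his : i ∈ s
      · simpa [f, hi, his] using integral_exp_neg_mul_sq_gaussianReal ht
      · simp [f, hi, his]
  have hprod := Integrable.fintype_prod (μ := fun _ : ι => gaussianReal 0 1) hint
  simp_rw [← hf]
  rw [← ofReal_integral_eq_lintegral_ofReal hprod
      (Filter.Eventually.of_forall fun h => by
        simp only [hf, Pi.zero_apply]
        positivity),
    integral_fintype_prod_eq_prod]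
  simp_rw [hval]
  rw [Finset.prod_ite_mem, Finset.univ_inter, Finset.prod_const, ← Real.rpow_mul_natCast
    (by positivity)]
  congr 2
  ring

theorem ofReal_div_le_lintegral_mul_exp {a S : ℝ} (ha : 0 ≤ a) (hS : 0 ≤ S) :
    ENNReal.ofReal (a / S) ≤
      ∫⁻ t in Set.Ioi (0 : ℝ), ENNReal.ofReal (a * Real.exp (-(t * S))) := by
  rcases hS.eq_or_lt with rfl | hS
  · simp
  have he : ∀ t : ℝ, a * Real.exp (-(t * S)) = a * Real.exp (-S * t) := fun t => by ring_nf
  simp_rw [he]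
  rw [← ofReal_integral_eq_lintegral_ofReal
    ((integrableOn_exp_mul_Ioi (by linarith : -S < 0) 0).const_mul a)
    (Filter.Eventually.of_forall fun t => by
      simp only [Pi.zero_apply]
      positivity), integral_const_mul, integral_exp_mul_Ioi (by linarith : -S < 0)]
  simp [div_eq_mul_inv]

theorem lintegral_sq_div_sum_sq_pi_gaussianReal_le {ι : Type*} [Fintype ι]
    {s : Finset ι} {j : ι} (hj : j ∉ s) (hs : 2 < s.card) :
    ∫⁻ h : ι → ℝ, ENNReal.ofReal (h j ^ 2 / ∑ i ∈ s, h i ^ 2)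
        ∂(Measure.pi fun _ => gaussianReal 0 1) ≤
      ENNReal.ofReal (1 / ((s.card : ℝ) - 2)) := by
  calc _ ≤ ∫⁻ h : ι → ℝ, (∫⁻ t in Set.Ioi (0 : ℝ),
          ENNReal.ofReal (h j ^ 2 * Real.exp (-(t * ∑ i ∈ s, h i ^ 2))))
          ∂(Measure.pi fun _ => gaussianReal 0 1) :=
        lintegral_mono fun h => ofReal_div_le_lintegral_mul_exp (sq_nonneg _)
          (Finset.sum_nonneg fun i _ => sq_nonneg _)
    _ = ∫⁻ t in Set.Ioi (0 : ℝ), ∫⁻ h : ι → ℝ,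
          ENNReal.ofReal (h j ^ 2 * Real.exp (-(t * ∑ i ∈ s, h i ^ 2)))
          ∂(Measure.pi fun _ => gaussianReal 0 1) :=
        lintegral_lintegral_swap (by fun_prop)
    _ = ∫⁻ t in Set.Ioi (0 : ℝ), ENNReal.ofReal ((1 + 2 * t) ^ (-((s.card : ℝ) / 2))) :=
        setLIntegral_congr_fun measurableSet_Ioi fun t ht =>
          lintegral_sq_mul_exp_neg_mul_sum_sq_pi_gaussianReal hj (le_of_lt ht)
    _ = _ := lintegral_one_add_two_mul_rpow (by exact_mod_cast hs)

theorem integrable_sq_div_sum_sq_pi_gaussianReal {ι : Type*} [Fintype ι]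
    {s : Finset ι} {j : ι} (hj : j ∉ s) (hs : 2 < s.card) :
    Integrable (fun h : ι → ℝ => h j ^ 2 / ∑ i ∈ s, h i ^ 2)
      (Measure.pi fun _ => gaussianReal 0 1) := by
  refine ⟨Measurable.aestronglyMeasurable (by fun_prop), ?_⟩
  rw [hasFiniteIntegral_iff_ofReal (Filter.Eventually.of_forall fun h => by
    simp only [Pi.zero_apply]
    positivity)]
  exact (lintegral_sq_div_sum_sq_pi_gaussianReal_le hj hs).trans_lt ENNReal.ofReal_lt_top

theorem integral_sq_div_sum_sq_pi_gaussianReal_le {ι : Type*} [Fintype ι]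
    {s : Finset ι} {j : ι} (hj : j ∉ s) (hs : 2 < s.card) :
    ∫ h : ι → ℝ, h j ^ 2 / ∑ i ∈ s, h i ^ 2 ∂(Measure.pi fun _ => gaussianReal 0 1) ≤
      1 / ((s.card : ℝ) - 2) := by
  have hs' : (2 : ℝ) < s.card := by exact_mod_cast hs
  rw [← ENNReal.ofReal_le_ofReal_iff (one_div_nonneg.2 (by linarith)),
    ofReal_integral_eq_lintegral_ofReal (integrable_sq_div_sum_sq_pi_gaussianReal hj hs)
      (Filter.Eventually.of_forall fun h => by
        simp only [Pi.zero_apply]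
        positivity)]
  exact lintegral_sq_div_sum_sq_pi_gaussianReal_le hj hs

theorem integral_sqrt_div_sqrt_pi_gaussianReal_le {ι : Type*} [Fintype ι]
    {s : Finset ι} (hs : 2 < s.card) :
    ∫ h : ι → ℝ, √(∑ i, h i ^ 2) / √(∑ i ∈ s, h i ^ 2)
        ∂(Measure.pi fun _ => gaussianReal 0 1) ≤
      √(((Fintype.card ι : ℝ) - 2) / ((s.card : ℝ) - 2)) := by
  classical
  have hs' : (0 : ℝ) < (s.card : ℝ) - 2 := by
    have : (2 : ℝ) < s.card := by exact_mod_cast hs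
    linarith
  have hcard : (s.card : ℝ) + (sᶜ.card : ℝ) = Fintype.card ι := by
    exact_mod_cast s.card_add_card_compl
  have hpos : 0 < ((Fintype.card ι : ℝ) - 2) / ((s.card : ℝ) - 2) :=
    div_pos (by linarith [(Nat.cast_nonneg sᶜ.card : (0 : ℝ) ≤ _)]) hs'
  set m := √(((Fintype.card ι : ℝ) - 2) / ((s.card : ℝ) - 2))
  have hm0 : 0 < m := Real.sqrt_pos.2 hpos
  have hmsq : m ^ 2 = ((Fintype.card ι : ℝ) - 2) / ((s.card : ℝ) - 2) := Real.sq_sqrt hpos.le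
  let R : (ι → ℝ) → ℝ := fun h => 1 + ∑ j ∈ sᶜ, h j ^ 2 / ∑ i ∈ s, h i ^ 2
  have hRint : Integrable (fun h => ∑ j ∈ sᶜ, h j ^ 2 / ∑ i ∈ s, h i ^ 2)
      (Measure.pi fun _ : ι => gaussianReal 0 1) :=
    integrable_finsetSum _ fun j hj =>
      integrable_sq_div_sum_sq_pi_gaussianReal (Finset.mem_compl.1 hj) hs
  have hRint' : Integrable R (Measure.pi fun _ : ι => gaussianReal 0 1) :=
    (integrable_const 1).add hRint
  have hR : ∫ h, R h ∂(Measure.pi fun _ : ι => gaussianReal 0 1) ≤ m ^ 2 := by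
    rw [integral_add (integrable_const _) hRint, integral_finsetSum _ fun j hj =>
      integrable_sq_div_sum_sq_pi_gaussianReal (Finset.mem_compl.1 hj) hs]
    have := Finset.sum_le_card_nsmul sᶜ (fun j => ∫ h : ι → ℝ, h j ^ 2 / ∑ i ∈ s, h i ^ 2
        ∂(Measure.pi fun _ => gaussianReal 0 1)) _ fun j hj =>
      integral_sq_div_sum_sq_pi_gaussianReal_le (Finset.mem_compl.1 hj) hs
    rw [nsmul_eq_mul] at this
    have heq : m ^ 2 = 1 + (sᶜ.card : ℝ) * (1 / ((s.card : ℝ) - 2)) := by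
      rw [hmsq, ← hcard]
      field_simp
      ring
    simp only [integral_const, probReal_univ, one_smul]
    linarith
  have hCsq : ∀ h : ι → ℝ, (√(∑ i, h i ^ 2) / √(∑ i ∈ s, h i ^ 2)) ^ 2 ≤ R h := fun h => by
    rw [div_pow, Real.sq_sqrt (by positivity), Real.sq_sqrt (by positivity),
      ← Finset.sum_add_sum_compl s, add_div, Finset.sum_div sᶜ]
    exact add_le_add (div_self_le_one _) le_rfl
  calc _ ≤ ∫ h, (R h + m ^ 2) / (2 * m) ∂(Measure.pi fun _ : ι => gaussianReal 0 1) := by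
        refine integral_mono_of_nonneg (Filter.Eventually.of_forall fun h => by
          simp only [Pi.zero_apply]
          positivity) ((hRint'.add (integrable_const _)).div_const _)
          (Filter.Eventually.of_forall fun h => ?_)
        simp only
        rw [le_div_iff₀ (by positivity)]
        nlinarith [hCsq h, sq_nonneg (√(∑ i, h i ^ 2) / √(∑ i ∈ s, h i ^ 2) - m)]
    _ = ((∫ h, R h ∂(Measure.pi fun _ : ι => gaussianReal 0 1)) + m ^ 2) / (2 * m) := by
        rw [integral_div, integral_add hRint' (integrable_const _)]
        simp
    _ ≤ m := by
        rw [div_le_iff₀ (by positivity)]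
        nlinarith

/-- For a standard Gaussian vector `h` in `ℝ^L`, `2 < T ≤ L`, and
`C = sqrt(∑_{i≤L} h_i²)/sqrt(∑_{i≤T} h_i²)`, we have `E[C] ≤ sqrt((L-2)/(T-2))`. -/
theorem stmt10 (L T : ℕ) (hT : 2 < T) (hTL : T ≤ L) :
    ∫ h : Fin L → ℝ,
        Real.sqrt (∑ i, h i ^ 2) /
          Real.sqrt (∑ i ∈ Finset.univ.filter fun i : Fin L => (i : ℕ) < T, h i ^ 2)
        ∂(Measure.pi fun _ : Fin L => gaussianReal 0 1)
      ≤ Real.sqrt (((L : ℝ) - 2) / ((T : ℝ) - 2)) := by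
  have hcard : (Finset.univ.filter fun i : Fin L => (i : ℕ) < T).card = T := by
    rw [Fin.card_filter_val_lt, min_eq_right hTL]
  have h := integral_sqrt_div_sqrt_pi_gaussianReal_le (hT.trans_eq hcard.symm)
  rwa [hcard, Fintype.card_fin] at h
end

section
/- Let h be a standard Gaussian vector in ℝ^L, 2 < T ≤ L, and C = sqrt(∑_{i=1}^L h_i²)/sqrt(∑_{i=1}^T h_i²). Then Var(C) ≤ (L-2)/(T-2) − L/T. -/
open MeasureTheory ProbabilityTheory

lemma gaussianReal_integral_exp_neg_mul_sq {s : ℝ} (hs : 0 ≤ s) :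
    ∫ x, Real.exp (-(s * x ^ 2)) ∂(gaussianReal 0 1) = (1 + 2 * s) ^ (-(1 / 2) : ℝ) := by
  have hs' : 0 < 1 + 2 * s := by positivity
  rw [integral_gaussianReal_eq_integral_smul one_ne_zero]
  have h (x : ℝ) : gaussianPDFReal 0 1 x • Real.exp (-(s * x ^ 2)) =
      (√(2 * Real.pi))⁻¹ * Real.exp (-((1 + 2 * s) / 2) * x ^ 2) := by
    rw [gaussianPDFReal, smul_eq_mul, mul_assoc, ← Real.exp_add]
    simp only [NNReal.coe_one, mul_one, sub_zero]
    ring_nf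
  simp_rw [h]
  rw [integral_const_mul, integral_gaussian, Real.rpow_neg hs'.le, ← Real.sqrt_eq_rpow,
    ← Real.sqrt_inv, ← Real.sqrt_inv, ← Real.sqrt_mul (by positivity)]
  congr 1
  field_simp

lemma gaussianReal_integrable_exp_neg_mul_sq {s : ℝ} (hs : 0 ≤ s) :
    Integrable (fun x => Real.exp (-(s * x ^ 2))) (gaussianReal 0 1) := by
  refine Integrable.of_bound (by fun_prop) 1 (ae_of_all _ fun x => ?_)
  rw [Real.norm_eq_abs, Real.abs_exp, Real.exp_le_one_iff]
  have := mul_nonneg hs (sq_nonneg x)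
  linarith

lemma gaussianReal_integral_sq : ∫ x : ℝ, x ^ 2 ∂(gaussianReal 0 1) = 1 := by
  have h := variance_fun_id_gaussianReal (μ := 0) (v := 1)
  rw [variance_eq_integral (by fun_prop)] at h
  simpa using h

lemma gaussianReal_integrable_sq : Integrable (fun x : ℝ => x ^ 2) (gaussianReal 0 1) :=
  (memLp_id_gaussianReal (μ := 0) (v := 1) 2).integrable_sq

lemma integral_Ioi_one_add_two_mul_rpow {a : ℝ} (ha : 2 < a) :
    IntegrableOn (fun s : ℝ => (1 + 2 * s) ^ (-(a / 2))) (Set.Ioi 0) ∧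
      ∫ s in Set.Ioi (0 : ℝ), (1 + 2 * s) ^ (-(a / 2)) = 1 / (a - 2) := by
  have hd : ∀ s ∈ Set.Ici (0 : ℝ),
      HasDerivAt (fun s : ℝ => -((1 + 2 * s) ^ (-((a - 2) / 2))) / (a - 2))
        ((1 + 2 * s) ^ (-(a / 2))) s := by
    intro s hs
    have hs : (0 : ℝ) ≤ s := hs
    have hlin : HasDerivAt (fun s : ℝ => 1 + 2 * s) 2 s := by
      simpa using ((hasDerivAt_id s).const_mul 2).const_add 1
    have h := ((hlin.rpow_const (p := -((a - 2) / 2))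
      (Or.inl (by positivity))).neg).div_const (a - 2)
    refine h.congr_deriv ?_
    have : a - 2 ≠ 0 := by linarith
    rw [show -((a - 2) / 2) - 1 = -(a / 2) by ring]
    field_simp
  have hnn : ∀ s ∈ Set.Ioi (0 : ℝ), 0 ≤ (1 + 2 * s) ^ (-(a / 2)) := fun s hs => by
    have hs : (0 : ℝ) < s := hs
    positivity
  have hlim : Filter.Tendsto (fun s : ℝ => -((1 + 2 * s) ^ (-((a - 2) / 2))) / (a - 2))
      Filter.atTop (nhds (-0 / (a - 2))) := by
    refine Filter.Tendsto.div_const (Filter.Tendsto.neg ?_) _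
    refine (tendsto_rpow_neg_atTop (by linarith)).comp ?_
    exact Filter.tendsto_atTop_add_const_left _ _
      (Filter.tendsto_id.const_mul_atTop (by norm_num))
  refine ⟨integrableOn_Ioi_deriv_of_nonneg' hd hnn hlim, ?_⟩
  rw [integral_Ioi_of_hasDerivAt_of_nonneg' hd hnn hlim]
  simp [neg_div]

section GaussianVector

variable {ι : Type*} [Fintype ι]

lemma pi_gaussianReal_lintegral_sq_mul_exp {S : Finset ι} {j : ι} (hj : j ∉ S) {s : ℝ}
    (hs : 0 ≤ s) :
    ∫⁻ h : ι → ℝ, ENNReal.ofReal (h j ^ 2 * Real.exp (-(s * ∑ i ∈ S, h i ^ 2)))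
        ∂(Measure.pi fun _ => gaussianReal 0 1) =
      ENNReal.ofReal ((1 + 2 * s) ^ (-((S.card : ℝ) / 2))) := by
  classical
  let F : ι → ℝ → ℝ := fun i x =>
    (if i = j then x ^ 2 else 1) * (if i ∈ S then Real.exp (-(s * x ^ 2)) else 1)
  have hF (h : ι → ℝ) :
      h j ^ 2 * Real.exp (-(s * ∑ i ∈ S, h i ^ 2)) = ∏ i, F i (h i) := by
    simp only [F, Finset.prod_mul_distrib, Finset.prod_ite_eq', Finset.mem_univ, if_true,
      Finset.prod_ite_mem, Finset.univ_inter, ← Real.exp_sum, Finset.sum_neg_distrib,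
      Finset.mul_sum]
  have hFi (i : ι) : Integrable (F i) (gaussianReal 0 1) ∧
      ∫ x, F i x ∂(gaussianReal 0 1) =
        if i ∈ S then (1 + 2 * s) ^ (-(1 / 2) : ℝ) else 1 := by
    by_cases hij : i = j
    · subst hij
      simpa [F, hj] using ⟨gaussianReal_integrable_sq, gaussianReal_integral_sq⟩
    · by_cases hi : i ∈ S
      · simpa only [F, hij, hi, if_true, if_false, one_mul] using
          And.intro (gaussianReal_integrable_exp_neg_mul_sq hs)
            (gaussianReal_integral_exp_neg_mul_sq hs)
      · simp [F, hij, hi]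
  simp_rw [hF]
  rw [← ofReal_integral_eq_lintegral_ofReal
    (Integrable.fintype_prod_dep fun i => (hFi i).1)
    (ae_of_all _ fun h => by
      simp only [Pi.zero_apply, ← hF]
      positivity),
    integral_fintype_prod_eq_prod]
  simp_rw [fun i => (hFi i).2]
  rw [Finset.prod_ite_mem, Finset.univ_inter, Finset.prod_const, ← Real.rpow_natCast,
    ← Real.rpow_mul (by positivity)]
  ring_nf

lemma pi_gaussianReal_integral_sq_div_sum_sq {S : Finset ι} {j : ι} (hj : j ∉ S)
    (hS : 2 < S.card) :
    Integrable (fun h : ι → ℝ => h j ^ 2 / ∑ i ∈ S, h i ^ 2)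
        (Measure.pi fun _ => gaussianReal 0 1) ∧
      ∫ h : ι → ℝ, h j ^ 2 / ∑ i ∈ S, h i ^ 2 ∂(Measure.pi fun _ => gaussianReal 0 1) ≤
        1 / ((S.card : ℝ) - 2) := by
  have hS' : (2 : ℝ) < S.card := by exact_mod_cast hS
  have hpt (h : ι → ℝ) : ENNReal.ofReal (h j ^ 2 / ∑ i ∈ S, h i ^ 2) ≤
      ∫⁻ s in Set.Ioi (0 : ℝ),
        ENNReal.ofReal (h j ^ 2 * Real.exp (-(s * ∑ i ∈ S, h i ^ 2))) := by
    have hA : 0 ≤ ∑ i ∈ S, h i ^ 2 := Finset.sum_nonneg fun i _ => sq_nonneg _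
    rcases hA.eq_or_lt with hA | hA
    · simp [← hA]
    · have hexp (s : ℝ) : -(s * ∑ i ∈ S, h i ^ 2) = (-∑ i ∈ S, h i ^ 2) * s := by ring
      simp_rw [hexp]
      rw [← ofReal_integral_eq_lintegral_ofReal
        ((integrableOn_exp_mul_Ioi (neg_neg_of_pos hA) 0).const_mul _)
        (ae_of_all _ fun s => mul_nonneg (sq_nonneg _) (Real.exp_pos _).le),
        integral_const_mul, integral_exp_mul_Ioi (neg_neg_of_pos hA)]
      simp [div_eq_mul_inv]
  have hle : ∫⁻ h : ι → ℝ, ENNReal.ofReal (h j ^ 2 / ∑ i ∈ S, h i ^ 2)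
      ∂(Measure.pi fun _ => gaussianReal 0 1) ≤ ENNReal.ofReal (1 / ((S.card : ℝ) - 2)) := by
    refine (lintegral_mono hpt).trans ?_
    rw [lintegral_lintegral_swap (Measurable.aemeasurable (by fun_prop)),
      setLIntegral_congr_fun measurableSet_Ioi
        fun s (hs : 0 < s) => pi_gaussianReal_lintegral_sq_mul_exp hj hs.le]
    obtain ⟨hint, hval⟩ := integral_Ioi_one_add_two_mul_rpow hS'
    rw [← hval, ofReal_integral_eq_lintegral_ofReal hint]
    refine (ae_restrict_mem measurableSet_Ioi).mono fun s (hs : 0 < s) => ?_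
    simp only [Pi.zero_apply]
    positivity
  have hnn (h : ι → ℝ) : 0 ≤ h j ^ 2 / ∑ i ∈ S, h i ^ 2 := by positivity
  have hmeas : Measurable fun h : ι → ℝ => h j ^ 2 / ∑ i ∈ S, h i ^ 2 := by fun_prop
  constructor
  · refine ⟨hmeas.aestronglyMeasurable, ?_⟩
    rw [hasFiniteIntegral_iff_ofReal (ae_of_all _ hnn)]
    exact hle.trans_lt ENNReal.ofReal_lt_top
  · rw [integral_eq_lintegral_of_nonneg_ae (ae_of_all _ hnn) hmeas.aestronglyMeasurable]
    exact ENNReal.toReal_le_of_le_ofReal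
      (one_div_nonneg.2 (by linarith)) hle

lemma integrable_sum_sq_div_sum_sq (S : Finset ι) (μ : Measure (ι → ℝ)) [IsFiniteMeasure μ] :
    Integrable (fun h : ι → ℝ => (∑ i ∈ S, h i ^ 2) / ∑ i, h i ^ 2) μ := by
  refine Integrable.of_bound (Measurable.aestronglyMeasurable (by fun_prop)) 1
    (ae_of_all _ fun h => ?_)
  rw [Real.norm_of_nonneg (by positivity)]
  exact div_le_one_of_le₀ (Finset.sum_le_univ_sum_of_nonneg fun i => sq_nonneg _) (by positivity)

/-- By exchangeability of the coordinates, each `h i ^ 2 / ∑ k, h k ^ 2` has the same mean. -/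
lemma pi_integral_sum_sq_div_sum_sq_le [Nonempty ι] (S : Finset ι) (ν : Measure ℝ)
    [IsProbabilityMeasure ν] :
    ∫ h : ι → ℝ, (∑ i ∈ S, h i ^ 2) / ∑ i, h i ^ 2 ∂(Measure.pi fun _ => ν) ≤
      (S.card : ℝ) / Fintype.card ι := by
  classical
  set μ : Measure (ι → ℝ) := Measure.pi fun _ => ν
  have hint (i : ι) : Integrable (fun h : ι → ℝ => h i ^ 2 / ∑ k, h k ^ 2) μ := by
    simpa using integrable_sum_sq_div_sum_sq {i} μ
  have hexch (i j : ι) : ∫ h : ι → ℝ, h i ^ 2 / ∑ k, h k ^ 2 ∂μ =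
      ∫ h : ι → ℝ, h j ^ 2 / ∑ k, h k ^ 2 ∂μ := by
    let e := Equiv.swap i j
    have hmp : MeasurePreserving (MeasurableEquiv.piCongrLeft (fun _ : ι => ℝ) e) μ μ :=
      measurePreserving_piCongrLeft (fun _ : ι => ν) e
    rw [← hmp.integral_comp' (g := fun h : ι → ℝ => h i ^ 2 / ∑ k, h k ^ 2)]
    refine integral_congr_ae (ae_of_all _ fun h => ?_)
    have happ (k : ι) : MeasurableEquiv.piCongrLeft (fun _ : ι => ℝ) e h (e k) = h k :=
      MeasurableEquiv.piCongrLeft_apply_apply (β := fun _ => ℝ) e h k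
    have hi := happ j
    rw [show e j = i from Equiv.swap_apply_right i j] at hi
    simp only [hi]
    rw [← Equiv.sum_comp e
      fun k => MeasurableEquiv.piCongrLeft (fun _ : ι => ℝ) e h k ^ 2]
    simp only [happ]
  obtain ⟨i₀⟩ := ‹Nonempty ι›
  have hsum (R : Finset ι) : ∫ h : ι → ℝ, (∑ i ∈ R, h i ^ 2) / ∑ i, h i ^ 2 ∂μ =
      R.card * ∫ h : ι → ℝ, h i₀ ^ 2 / ∑ k, h k ^ 2 ∂μ := by
    simp_rw [Finset.sum_div]
    rw [integral_finsetSum _ fun i _ => hint i, Finset.sum_congr rfl fun i _ => hexch i i₀,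
      Finset.sum_const, nsmul_eq_mul]
  have htot : ∫ h : ι → ℝ, (∑ i, h i ^ 2) / ∑ i, h i ^ 2 ∂μ ≤ 1 := by
    refine (integral_mono (integrable_sum_sq_div_sum_sq Finset.univ μ) (integrable_const 1)
      fun h => div_self_le_one _).trans ?_
    simp
  have hcard : (0 : ℝ) < Fintype.card ι := by
    exact_mod_cast Fintype.card_pos_iff.2 ⟨i₀⟩
  rw [hsum, Finset.card_univ] at htot
  rw [hsum, div_eq_mul_inv]
  gcongr
  rw [← one_div, le_div_iff₀ hcard]
  linarith

lemma pi_gaussianReal_ae_sum_sq_pos {S : Finset ι} (hS : S.Nonempty) :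
    ∀ᵐ h : ι → ℝ ∂(Measure.pi fun _ => gaussianReal 0 1), 0 < ∑ i ∈ S, h i ^ 2 := by
  obtain ⟨i, hi⟩ := hS
  have := nullSingletonClass_gaussianReal (μ := 0) one_ne_zero
  have hne : ∀ᵐ x ∂(gaussianReal 0 1), x ≠ 0 := Measure.ae_ne _ 0
  filter_upwards [(Measure.quasiMeasurePreserving_eval
    (μ := fun _ : ι => gaussianReal 0 1) i).ae hne] with h hh
  have hh : h i ≠ 0 := hh
  exact Finset.sum_pos' (fun k _ => sq_nonneg _) ⟨i, hi, by positivity⟩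

lemma pi_gaussianReal_integral_sum_sq_div_sum_sq {S : Finset ι} (hS : 2 < S.card) :
    Integrable (fun h : ι → ℝ => (∑ i, h i ^ 2) / ∑ i ∈ S, h i ^ 2)
        (Measure.pi fun _ => gaussianReal 0 1) ∧
      ∫ h : ι → ℝ, (∑ i, h i ^ 2) / ∑ i ∈ S, h i ^ 2 ∂(Measure.pi fun _ => gaussianReal 0 1) ≤
        ((Fintype.card ι : ℝ) - 2) / ((S.card : ℝ) - 2) := by
  classical
  have hS' : (2 : ℝ) < S.card := by exact_mod_cast hS
  have hsplit : (fun h : ι → ℝ => (∑ i, h i ^ 2) / ∑ i ∈ S, h i ^ 2)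
      =ᵐ[Measure.pi fun _ => gaussianReal 0 1]
      fun h => 1 + ∑ j ∈ Sᶜ, h j ^ 2 / ∑ i ∈ S, h i ^ 2 := by
    filter_upwards [pi_gaussianReal_ae_sum_sq_pos (Finset.card_pos.1 (by omega : 0 < S.card))]
      with h hh
    rw [← Finset.sum_add_sum_compl S, add_div, div_self hh.ne', Finset.sum_div]
  have hterm (j : ι) (hj : j ∈ Sᶜ) :=
    pi_gaussianReal_integral_sq_div_sum_sq (Finset.mem_compl.1 hj) hS
  have hint := integrable_finsetSum Sᶜ fun j hj => (hterm j hj).1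
  refine ⟨((integrable_const 1).add hint).congr hsplit.symm, ?_⟩
  rw [integral_congr_ae hsplit, integral_add (integrable_const 1) hint,
    integral_finsetSum _ fun j hj => (hterm j hj).1]
  refine (add_le_add_right (Finset.sum_le_sum fun j hj => (hterm j hj).2) _).trans_eq ?_
  rw [Finset.sum_const, Finset.card_compl, nsmul_eq_mul, Nat.cast_sub (Finset.card_le_univ S)]
  have : (S.card : ℝ) - 2 ≠ 0 := by linarith
  simp
  field_simp
  ring

/-- The tangent line inequality for `x ↦ 1 / √x` at `1 / k ^ 2`, evaluated at `1 / c ^ 2`. -/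
lemma tangent_le_of_pos {c k : ℝ} (hc : 0 < c) (hk : 0 < k) :
    3 / 2 * k - k ^ 3 / 2 * (c ^ 2)⁻¹ ≤ c := by
  have h : c - (3 / 2 * k - k ^ 3 / 2 * (c ^ 2)⁻¹) =
      (c - k) ^ 2 * (2 * c + k) / (2 * c ^ 2) := by
    field_simp
    ring
  have : 0 ≤ (c - k) ^ 2 * (2 * c + k) / (2 * c ^ 2) := by positivity
  linarith

lemma pi_gaussianReal_sqrt_le_integral_sqrt_div_sqrt {S : Finset ι} (hS : 2 < S.card) :
    √((Fintype.card ι : ℝ) / S.card) ≤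
      ∫ h : ι → ℝ, √(∑ i, h i ^ 2) / √(∑ i ∈ S, h i ^ 2)
        ∂(Measure.pi fun _ => gaussianReal 0 1) := by
  have hST : (S.card : ℝ) ≤ Fintype.card ι := by exact_mod_cast Finset.card_le_univ S
  have hS0 : (0 : ℝ) < S.card := by exact_mod_cast (by omega : 0 < S.card)
  have hL0 : (0 : ℝ) < Fintype.card ι := hS0.trans_le hST
  have hSne : S.Nonempty := Finset.card_pos.1 (by omega)
  have : Nonempty ι := ⟨hSne.choose⟩
  set μ : Measure (ι → ℝ) := Measure.pi fun _ => gaussianReal 0 1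
  set k := √((Fintype.card ι : ℝ) / S.card)
  have hk : 0 < k := by positivity
  have hk2 : k ^ 2 = (Fintype.card ι : ℝ) / S.card := Real.sq_sqrt (by positivity)
  have hCint : Integrable (fun h : ι → ℝ => √(∑ i, h i ^ 2) / √(∑ i ∈ S, h i ^ 2)) μ := by
    refine MemLp.integrable one_le_two ((memLp_two_iff_integrable_sq
      (Measurable.aestronglyMeasurable (by fun_prop))).2 ?_)
    refine (pi_gaussianReal_integral_sum_sq_div_sum_sq hS).1.congr (ae_of_all _ fun h => ?_)
    simp only [div_pow]
    rw [Real.sq_sqrt (by positivity), Real.sq_sqrt (by positivity)]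
  have hXint := integrable_sum_sq_div_sum_sq S μ
  have hmono : ∫ h : ι → ℝ, 3 / 2 * k - k ^ 3 / 2 * ((∑ i ∈ S, h i ^ 2) / ∑ i, h i ^ 2) ∂μ ≤
      ∫ h : ι → ℝ, √(∑ i, h i ^ 2) / √(∑ i ∈ S, h i ^ 2) ∂μ := by
    refine integral_mono_ae ((integrable_const _).sub (hXint.const_mul _)) hCint ?_
    filter_upwards [pi_gaussianReal_ae_sum_sq_pos hSne] with h hA
    have hN : 0 < ∑ i, h i ^ 2 :=
      hA.trans_le (Finset.sum_le_univ_sum_of_nonneg fun i => sq_nonneg _)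
    have ht := tangent_le_of_pos (c := √(∑ i, h i ^ 2) / √(∑ i ∈ S, h i ^ 2)) (by positivity) hk
    rwa [div_pow, Real.sq_sqrt hN.le, Real.sq_sqrt hA.le, inv_div] at ht
  rw [integral_sub (integrable_const _) (hXint.const_mul _), integral_const,
    integral_const_mul] at hmono
  have hX : k ^ 3 / 2 * ∫ h : ι → ℝ, (∑ i ∈ S, h i ^ 2) / ∑ i, h i ^ 2 ∂μ ≤ k / 2 := by
    calc _ ≤ k ^ 3 / 2 * ((S.card : ℝ) / Fintype.card ι) := by
          gcongr
          exact pi_integral_sum_sq_div_sum_sq_le S _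
      _ = k / 2 := by
          rw [pow_succ, hk2]
          field_simp
  simp only [probReal_univ, one_smul] at hmono
  linarith

end GaussianVector

/-- For a standard Gaussian vector `h` in `ℝ^L`, `2 < T ≤ L`, and
`C = sqrt(∑_{i≤L} h_i²)/sqrt(∑_{i≤T} h_i²)`, `Var(C) ≤ (L-2)/(T-2) - L/T`. -/
theorem stmt11 (L T : ℕ) (hT : 2 < T) (hTL : T ≤ L)
    (C : (Fin L → ℝ) → ℝ)
    (hC : ∀ h, C h = Real.sqrt (∑ i, h i ^ 2) /
        Real.sqrt (∑ i ∈ Finset.univ.filter fun i : Fin L => (i : ℕ) < T, h i ^ 2)) :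
    (∫ h : Fin L → ℝ, C h ^ 2 ∂(Measure.pi fun _ : Fin L => gaussianReal 0 1)) -
        (∫ h : Fin L → ℝ, C h ∂(Measure.pi fun _ : Fin L => gaussianReal 0 1)) ^ 2
      ≤ ((L : ℝ) - 2) / ((T : ℝ) - 2) - (L : ℝ) / T := by
  set S := Finset.univ.filter fun i : Fin L => (i : ℕ) < T
  have hcard : S.card = T := by simp [S, Fin.card_filter_val_lt, hTL]
  have hS : 2 < S.card := hcard.symm ▸ hT
  have hC2 (h : Fin L → ℝ) : C h ^ 2 = (∑ i, h i ^ 2) / ∑ i ∈ S, h i ^ 2 := by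
    rw [hC, div_pow, Real.sq_sqrt (by positivity), Real.sq_sqrt (by positivity)]
  have hsecond := (pi_gaussianReal_integral_sum_sq_div_sum_sq hS).2
  have hfirst := pi_gaussianReal_sqrt_le_integral_sqrt_div_sqrt hS
  simp_rw [← hC2] at hsecond
  simp_rw [← hC] at hfirst
  rw [hcard, Fintype.card_fin] at hsecond hfirst
  have hsq := pow_le_pow_left₀ (Real.sqrt_nonneg _) hfirst 2
  rw [Real.sq_sqrt (by positivity)] at hsq
  linarith
end
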